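/- arXiv:2404.15222 — 3 statements merged into one kernel-verified Lean document; each statement's English description precedes it below -/
import Mathlib

section
/- Let Ω̄ ⊂ ℝ^d be a compact set, G⁺, G⁻ : Ω̄ × Ω̄ → [0,∞) bounded Borel kernels, μ₀ a finite positive Borel measure on Ω̄, and w₀, h : Ω̄ → ℝ bounded Borel functions with 0 ≤ w₀ ≤ 1 and such that 0 ≤ w₀ + s h ≤ 1 on Ω̄ for all sufficiently small s > 0. Fix x ∈ Ω̄ and set A = ∫ G⁺(x,y)(1 − w₀(y)) dμ₀(y), B = ∫ G⁻(x,y) w₀(y) dμ₀(y), P = ∫ G⁺(x,y) h(y) dμ₀(y), Q = ∫ G⁻(x,y) h(y) dμ₀(y). If A + B > 0, then the one-sided limit as s → 0⁺ of (1/s)·[ψ(∫G⁺(x,·)(1−w₀−sh)dμ₀, ∫G⁻(x,·)(w₀+sh)dμ₀) − ψ(A,B)] exists and equals −(B·P + A·Q)/(A+B)². -/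
open MeasureTheory Metric Filter Topology

/-- `ψ(a,b) = a/(a+b)` with the convention `ψ(0,0) = 1`. -/
noncomputable def psi3 (a b : ℝ) : ℝ := if a = 0 ∧ b = 0 then 1 else a / (a + b)

theorem stmt3 (d : ℕ) (Ω : Set (EuclideanSpace ℝ (Fin d))) (hΩ : IsCompact Ω)
    (Gp Gm : EuclideanSpace ℝ (Fin d) → EuclideanSpace ℝ (Fin d) → ℝ)
    (hGpmeas : Measurable (Function.uncurry Gp))
    (hGmmeas : Measurable (Function.uncurry Gm))
    (hGpbdd : ∃ M : ℝ, ∀ x y, |Gp x y| ≤ M)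
    (hGmbdd : ∃ M : ℝ, ∀ x y, |Gm x y| ≤ M)
    (hGpnn : ∀ x ∈ Ω, ∀ y ∈ Ω, 0 ≤ Gp x y)
    (hGmnn : ∀ x ∈ Ω, ∀ y ∈ Ω, 0 ≤ Gm x y)
    (μ₀ : Measure (EuclideanSpace ℝ (Fin d))) [IsFiniteMeasure μ₀]
    (w₀ h : EuclideanSpace ℝ (Fin d) → ℝ)
    (hw₀meas : Measurable w₀) (hhmeas : Measurable h)
    (hw₀bdd : ∃ M : ℝ, ∀ y, |w₀ y| ≤ M) (hhbdd : ∃ M : ℝ, ∀ y, |h y| ≤ M)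
    (hw₀01 : ∀ y ∈ Ω, w₀ y ∈ Set.Icc (0 : ℝ) 1)
    (hsmall : ∃ s₀ > (0 : ℝ), ∀ s : ℝ, 0 < s → s ≤ s₀ →
      ∀ y ∈ Ω, w₀ y + s * h y ∈ Set.Icc (0 : ℝ) 1)
    (x : EuclideanSpace ℝ (Fin d)) (hx : x ∈ Ω)
    (A B P Q : ℝ)
    (hA : A = ∫ y in Ω, Gp x y * (1 - w₀ y) ∂μ₀)
    (hB : B = ∫ y in Ω, Gm x y * w₀ y ∂μ₀)
    (hP : P = ∫ y in Ω, Gp x y * h y ∂μ₀)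
    (hQ : Q = ∫ y in Ω, Gm x y * h y ∂μ₀)
    (hAB : 0 < A + B) :
    Tendsto (fun s : ℝ =>
        (1 / s) *
          (psi3 (∫ y in Ω, Gp x y * (1 - w₀ y - s * h y) ∂μ₀)
              (∫ y in Ω, Gm x y * (w₀ y + s * h y) ∂μ₀) -
            psi3 A B))
      (𝓝[>] 0) (𝓝 (-(B * P + A * Q) / (A + B) ^ 2)) := by
  have key : ∀ f g : EuclideanSpace ℝ (Fin d) → ℝ, Measurable f → Measurable g →
      (∃ M : ℝ, ∀ y, |f y| ≤ M) → (∃ M : ℝ, ∀ y, |g y| ≤ M) →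
      Integrable (fun y => f y * g y) (μ₀.restrict Ω) := by
    rintro f g hf hg ⟨M, hM⟩ ⟨N, hN⟩
    refine Integrable.of_bound (hf.mul hg).aestronglyMeasurable (M * N) (ae_of_all _ fun y => ?_)
    simp only [Pi.mul_apply, Real.norm_eq_abs, abs_mul]
    exact mul_le_mul (hM y) (hN y) (abs_nonneg _) ((abs_nonneg _).trans (hM y))
  have mp : Measurable (Gp x) := hGpmeas.comp measurable_prodMk_left
  have mm : Measurable (Gm x) := hGmmeas.comp measurable_prodMk_left
  have bp : ∃ M : ℝ, ∀ y, |Gp x y| ≤ M := hGpbdd.imp fun M hM => hM x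
  have bm : ∃ M : ℝ, ∀ y, |Gm x y| ≤ M := hGmbdd.imp fun M hM => hM x
  have b1 : ∃ M : ℝ, ∀ y, |1 - w₀ y| ≤ M := by
    obtain ⟨M, hM⟩ := hw₀bdd
    refine ⟨1 + M, fun y => (abs_sub _ _).trans ?_⟩
    have := hM y
    simpa using this
  have iA := key (Gp x) (fun y => 1 - w₀ y) mp (measurable_const.sub hw₀meas) bp b1
  have iB := key (Gm x) w₀ mm hw₀meas bm hw₀bdd
  have iP := key (Gp x) h mp hhmeas bp hhbdd
  have iQ := key (Gm x) h mm hhmeas bm hhbdd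
  have e1 : ∀ s : ℝ, (∫ y in Ω, Gp x y * (1 - w₀ y - s * h y) ∂μ₀) = A - s * P := by
    intro s
    rw [hA, hP, ← integral_const_mul, ← integral_sub iA (iP.const_mul s)]
    congr 1
    ext y
    ring
  have e2 : ∀ s : ℝ, (∫ y in Ω, Gm x y * (w₀ y + s * h y) ∂μ₀) = B + s * Q := by
    intro s
    rw [hB, hQ, ← integral_const_mul, ← integral_add iB (iQ.const_mul s)]
    congr 1
    ext y
    ring
  have psi_eq : ∀ a b : ℝ, 0 < a + b → psi3 a b = a / (a + b) := by
    intro a b hab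
    unfold psi3
    rw [if_neg]
    rintro ⟨rfl, rfl⟩
    simp at hab
  simp only [e1, e2]
  rw [psi_eq A B hAB]
  have hden : Tendsto (fun s : ℝ => A - s * P + (B + s * Q)) (𝓝[>] 0) (𝓝 (A + B)) := by
    have hc : Continuous (fun s : ℝ => A - s * P + (B + s * Q)) := by fun_prop
    have h0 := (hc.tendsto 0).mono_left (nhdsWithin_le_nhds (s := Set.Ioi 0))
    simpa using h0
  have hlim : Tendsto (fun s : ℝ => -(B * P + A * Q) / ((A + B) * (A - s * P + (B + s * Q))))
      (𝓝[>] 0) (𝓝 (-(B * P + A * Q) / (A + B) ^ 2)) := by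
    rw [pow_two]
    exact tendsto_const_nhds.div (tendsto_const_nhds.mul hden) (mul_pos hAB hAB).ne'
  refine hlim.congr' ?_
  filter_upwards [hden.eventually (lt_mem_nhds hAB), self_mem_nhdsWithin] with s hs hs0
  rw [psi_eq _ _ hs]
  have hs1 : s ≠ 0 := ne_of_gt hs0
  rw [div_sub_div _ _ hs.ne' hAB.ne', one_div, inv_mul_eq_div, div_div,
    div_eq_div_iff (mul_pos hAB hs).ne' (mul_ne_zero (mul_pos hs hAB).ne' hs1)]
  ring
end

section
/- Fix d ∈ ℕ and ρ ∈ (0, 1/2). Let G⁺, G⁻ : B̄_ρ × B̄_ρ → (0,∞) be continuous kernels, let μ be a finite positive Borel measure on B̄_ρ with μ ≠ 0, and let w : B̄_ρ → [0,1] be a Borel function satisfying, for every x ∈ B̄_ρ, w(x) = ψ(∫ G⁺(x,y)(1−w(y)) dμ(y), ∫ G⁻(x,y) w(y) dμ(y)). Then w is continuous on B̄_ρ and 0 < w(x) < 1 for all x ∈ B̄_ρ. -/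
open MeasureTheory Metric

/-- `ψ(a,b) = a/(a+b)` with the convention `ψ(0,0) = 1`. -/
noncomputable def psi6 (a b : ℝ) : ℝ := if a = 0 ∧ b = 0 then 1 else a / (a + b)

theorem kernel_aux6 {E : Type*} [NormedAddCommGroup E] [MeasurableSpace E] [BorelSpace E]
    [SecondCountableTopology E]
    (S : Set E) (hS : IsCompact S) (G : E → E → ℝ)
    (hG : ContinuousOn (fun p : E × E => G p.1 p.2) (S ×ˢ S))
    (hpos : ∀ x ∈ S, ∀ y ∈ S, 0 < G x y) (μ : Measure E) [IsFiniteMeasure μ]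
    (f : E → ℝ) (hf : Measurable f) (h01 : ∀ y ∈ S, 0 ≤ f y ∧ f y ≤ 1) :
    ContinuousOn (fun x => ∫ y in S, G x y * f y ∂μ) S ∧
    ∀ x ∈ S, 0 ≤ (∫ y in S, G x y * f y ∂μ) ∧
      ((∫ y in S, G x y * f y ∂μ) = 0 → ∀ᵐ y ∂(μ.restrict S), f y = 0) := by
  have hSm : MeasurableSet S := hS.isClosed.measurableSet
  obtain ⟨M, hM⟩ := (hS.prod hS).exists_bound_of_continuousOn hG
  have hmeas : ∀ x ∈ S, AEStronglyMeasurable (fun y => G x y * f y) (μ.restrict S) := by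
    intro x hx
    have h1 : ContinuousOn (fun y => G x y) S :=
      hG.comp (f := fun y => (x, y)) (by fun_prop) (fun y hy => ⟨hx, hy⟩)
    exact (h1.aestronglyMeasurable hSm).mul hf.aestronglyMeasurable
  have hbd : ∀ x ∈ S, ∀ᵐ y ∂(μ.restrict S), ‖G x y * f y‖ ≤ M := by
    intro x hx
    filter_upwards [ae_restrict_mem hSm] with y hy
    have h1 := hM (x, y) ⟨hx, hy⟩
    have h2 := h01 y hy
    rw [norm_mul, Real.norm_of_nonneg h2.1]
    simp only at h1
    nlinarith [norm_nonneg (G x y)]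
  refine ⟨?_, ?_⟩
  · refine continuousOn_of_dominated (bound := fun _ => M) hmeas hbd (integrable_const M) ?_
    filter_upwards [ae_restrict_mem hSm] with y hy
    have h1 : ContinuousOn (fun x => G x y) S :=
      hG.comp (f := fun x => (x, y)) (by fun_prop) (fun x hx => ⟨hx, hy⟩)
    exact h1.mul continuousOn_const
  · intro x hx
    have hnn : 0 ≤ᵐ[μ.restrict S] fun y => G x y * f y := by
      filter_upwards [ae_restrict_mem hSm] with y hy
      exact mul_nonneg (hpos x hx y hy).le (h01 y hy).1
    refine ⟨integral_nonneg_of_ae hnn, fun h0 => ?_⟩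
    have hint : Integrable (fun y => G x y * f y) (μ.restrict S) :=
      (integrable_const M).mono' (hmeas x hx) (hbd x hx)
    have h2 := (integral_eq_zero_iff_of_nonneg_ae hnn hint).1 h0
    filter_upwards [h2, ae_restrict_mem hSm] with y hy hyS
    exact (mul_eq_zero.1 hy).resolve_left (hpos x hx y hyS).ne'

theorem stmt6 (d : ℕ) (ρ : ℝ) (hρ0 : 0 < ρ) (hρ : ρ < 1 / 2)
    (Gp Gm : EuclideanSpace ℝ (Fin d) → EuclideanSpace ℝ (Fin d) → ℝ)
    (hGpc : ContinuousOn (fun p : EuclideanSpace ℝ (Fin d) × EuclideanSpace ℝ (Fin d) =>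
        Gp p.1 p.2)
      ((closedBall (0 : EuclideanSpace ℝ (Fin d)) ρ) ×ˢ
        (closedBall (0 : EuclideanSpace ℝ (Fin d)) ρ)))
    (hGmc : ContinuousOn (fun p : EuclideanSpace ℝ (Fin d) × EuclideanSpace ℝ (Fin d) =>
        Gm p.1 p.2)
      ((closedBall (0 : EuclideanSpace ℝ (Fin d)) ρ) ×ˢ
        (closedBall (0 : EuclideanSpace ℝ (Fin d)) ρ)))
    (hGppos : ∀ x ∈ closedBall (0 : EuclideanSpace ℝ (Fin d)) ρ,
      ∀ y ∈ closedBall (0 : EuclideanSpace ℝ (Fin d)) ρ, 0 < Gp x y)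
    (hGmpos : ∀ x ∈ closedBall (0 : EuclideanSpace ℝ (Fin d)) ρ,
      ∀ y ∈ closedBall (0 : EuclideanSpace ℝ (Fin d)) ρ, 0 < Gm x y)
    (μ : Measure (EuclideanSpace ℝ (Fin d))) [IsFiniteMeasure μ]
    (hμ : μ (closedBall (0 : EuclideanSpace ℝ (Fin d)) ρ) ≠ 0)
    (w : EuclideanSpace ℝ (Fin d) → ℝ) (hwmeas : Measurable w)
    (hw01 : ∀ y ∈ closedBall (0 : EuclideanSpace ℝ (Fin d)) ρ, w y ∈ Set.Icc (0 : ℝ) 1)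
    (hfix : ∀ x ∈ closedBall (0 : EuclideanSpace ℝ (Fin d)) ρ,
      w x = psi6 (∫ y in closedBall (0 : EuclideanSpace ℝ (Fin d)) ρ, Gp x y * (1 - w y) ∂μ)
        (∫ y in closedBall (0 : EuclideanSpace ℝ (Fin d)) ρ, Gm x y * w y ∂μ)) :
    ContinuousOn w (closedBall (0 : EuclideanSpace ℝ (Fin d)) ρ) ∧
    ∀ x ∈ closedBall (0 : EuclideanSpace ℝ (Fin d)) ρ, 0 < w x ∧ w x < 1 := by
  have hS : IsCompact (closedBall (0 : EuclideanSpace ℝ (Fin d)) ρ) := isCompact_closedBall _ _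
  generalize closedBall (0 : EuclideanSpace ℝ (Fin d)) ρ = S at *
  have hSm : MeasurableSet S := hS.isClosed.measurableSet
  obtain ⟨hac, ha⟩ := kernel_aux6 S hS Gp hGpc hGppos μ (fun y => 1 - w y)
    (measurable_const.sub hwmeas)
    (fun y hy => ⟨by linarith [(hw01 y hy).2], by linarith [(hw01 y hy).1]⟩)
  obtain ⟨hbc, hb⟩ := kernel_aux6 S hS Gm hGmc hGmpos μ w hwmeas (fun y hy => hw01 y hy)
  have hne : (ae (μ.restrict S)).NeBot := by
    rw [ae_neBot]
    simpa [Measure.restrict_eq_zero] using hμ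
  -- not both integrals vanish at possibly different points
  have hab : ∀ x ∈ S, ∀ x' ∈ S, (∫ y in S, Gp x y * (1 - w y) ∂μ) = 0 →
      (∫ y in S, Gm x' y * w y ∂μ) = 0 → False := by
    intro x hx x' hx' h1 h2
    have := ((ha x hx).2 h1).and ((hb x' hx').2 h2)
    obtain ⟨y, h3, h4⟩ := this.exists
    linarith
  have hapos : ∀ x ∈ S, 0 < ∫ y in S, Gp x y * (1 - w y) ∂μ := by
    intro x hx
    refine lt_of_le_of_ne (ha x hx).1 fun h => ?_
    have h1 := (ha x hx).2 h.symm
    obtain ⟨y, h3, h4⟩ := (h1.and (ae_restrict_mem hSm)).exists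
    have h5 : (∫ z in S, Gp y z * (1 - w z) ∂μ) = 0 := by
      apply integral_eq_zero_of_ae
      filter_upwards [h1] with z hz
      simp [hz]
    have h6 := hfix y h4
    rw [psi6, if_neg (fun hh => hab x hx y h4 h.symm hh.2), h5, zero_div] at h6
    linarith
  have hbpos : ∀ x ∈ S, 0 < ∫ y in S, Gm x y * w y ∂μ := by
    intro x hx
    refine lt_of_le_of_ne (hb x hx).1 fun h => ?_
    have h1 := (hb x hx).2 h.symm
    obtain ⟨y, h3, h4⟩ := (h1.and (ae_restrict_mem hSm)).exists
    have h5 : (∫ z in S, Gm y z * w z ∂μ) = 0 := by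
      apply integral_eq_zero_of_ae
      filter_upwards [h1] with z hz
      simp [hz]
    have h6 := hfix y h4
    have h7 := hapos y h4
    rw [psi6, if_neg (fun hh => h7.ne' hh.1), h5, add_zero, div_self h7.ne'] at h6
    linarith
  have hfix2 : ∀ x ∈ S, w x = (∫ y in S, Gp x y * (1 - w y) ∂μ) /
      ((∫ y in S, Gp x y * (1 - w y) ∂μ) + ∫ y in S, Gm x y * w y ∂μ) := by
    intro x hx
    have h := hfix x hx
    rwa [psi6, if_neg (fun hh => (hapos x hx).ne' hh.1)] at h
  refine ⟨?_, ?_⟩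
  · refine ContinuousOn.congr (hac.div (hac.add hbc) ?_) hfix2
    intro x hx
    exact (add_pos (hapos x hx) (hbpos x hx)).ne'
  · intro x hx
    have h1 := hapos x hx
    have h2 := hbpos x hx
    rw [hfix2 x hx]
    exact ⟨div_pos h1 (add_pos h1 h2), (div_lt_one (add_pos h1 h2)).2 (by linarith)⟩
end

section
/- Let χ ∈ C¹([0,∞)) with χ(0) = 0 and χ' bounded. Then for all z₁, z₂ ≥ 0: |z₁ χ(z₁) − z₂ χ(z₂)| ≤ sup_{s ≥ 0} |χ'(s)| · |z₁² − z₂²|. -/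
theorem stmt15 (χ χ' : ℝ → ℝ) (hχ0 : χ 0 = 0)
    (hderiv : ∀ s ∈ Set.Ici (0 : ℝ), HasDerivWithinAt χ (χ' s) (Set.Ici 0) s)
    (hcont : ContinuousOn χ' (Set.Ici 0))
    (hbdd : BddAbove ((fun s => |χ' s|) '' Set.Ici 0)) :
    ∀ z₁ z₂ : ℝ, 0 ≤ z₁ → 0 ≤ z₂ →
      |z₁ * χ z₁ - z₂ * χ z₂| ≤
        sSup ((fun s => |χ' s|) '' Set.Ici 0) * |z₁ ^ 2 - z₂ ^ 2| := by
  intro z₁ z₂ h₁ h₂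
  set M := sSup ((fun s => |χ' s|) '' Set.Ici 0) with hM
  have hb : ∀ s ∈ Set.Ici (0 : ℝ), ‖χ' s‖ ≤ M := fun s hs =>
    le_csSup hbdd ⟨s, hs, rfl⟩
  have lip : ∀ a b : ℝ, 0 ≤ a → 0 ≤ b → |χ a - χ b| ≤ M * |a - b| := fun a b ha hb' =>
    (convex_Ici (0 : ℝ)).norm_image_sub_le_of_norm_hasDerivWithin_le hderiv hb hb' ha
  have e1 := lip z₁ z₂ h₁ h₂
  have e2 := lip z₂ 0 h₂ le_rfl
  rw [hχ0, sub_zero, sub_zero, abs_of_nonneg h₂] at e2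
  have e3 : |z₁ ^ 2 - z₂ ^ 2| = |z₁ - z₂| * (z₁ + z₂) := by
    rw [← abs_of_nonneg (add_nonneg h₁ h₂), ← abs_mul]
    ring_nf
  calc |z₁ * χ z₁ - z₂ * χ z₂| = |z₁ * (χ z₁ - χ z₂) + (z₁ - z₂) * χ z₂| := by ring_nf
    _ ≤ z₁ * |χ z₁ - χ z₂| + |z₁ - z₂| * |χ z₂| := by
        refine (abs_add_le _ _).trans ?_
        rw [abs_mul, abs_mul, abs_of_nonneg h₁]
    _ ≤ z₁ * (M * |z₁ - z₂|) + |z₁ - z₂| * (M * z₂) := by gcongr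
    _ = M * |z₁ ^ 2 - z₂ ^ 2| := by rw [e3]; ring
end
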